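/- arXiv:2509.26314 — 2 statements merged into one kernel-verified Lean document; each statement's English description precedes it below -/
import Mathlib

section
/- Fix an integer N ≥ 1, a reference distribution π_ref on {1,…,N}, two reward functions r, r* : {1,…,N} → ℝ, β > 0, and ε ≥ 0. Suppose |r(i) − r*(i)| ≤ ε for all i ∈ {1,…,N}. Then the Kullback–Leibler divergence between the associated Gibbs distributions satisfies KL(π_r ‖ π_{r*}) ≤ 2ε/β. -/
/-- A pointwise bound `p i ≤ exp c * q i` on weights of total mass one bounds the
Kullback–Leibler divergence by `c`. -/
lemma sum_mul_log_div_le_of_le_exp_mul {ι : Type*} [Fintype ι] {p q : ι → ℝ} {c : ℝ}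
    (hp : ∀ i, 0 < p i) (hq : ∀ i, 0 < q i) (hsum : ∑ i, p i = 1)
    (h : ∀ i, p i ≤ Real.exp c * q i) :
    ∑ i, p i * Real.log (p i / q i) ≤ c := by
  calc ∑ i, p i * Real.log (p i / q i) ≤ ∑ i, p i * c := by
        refine Finset.sum_le_sum fun i _ => mul_le_mul_of_nonneg_left ?_ (hp i).le
        rw [Real.log_le_iff_le_exp (div_pos (hp i) (hq i)), div_le_iff₀ (hq i)]
        exact h i
    _ = c := by rw [← Finset.sum_mul, hsum, one_mul]

/-- If two positive weights agree up to a factor `exp c` in both directions, then so do their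
normalizations, up to a factor `exp (2 * c)`. -/
lemma div_sum_le_exp_mul_div_sum {ι : Type*} [Fintype ι] [Nonempty ι] {v w : ι → ℝ} {c : ℝ}
    (hv : ∀ i, 0 < v i) (hw : ∀ i, 0 < w i)
    (hvw : ∀ i, v i ≤ Real.exp c * w i) (hwv : ∀ i, w i ≤ Real.exp c * v i) (i : ι) :
    v i / ∑ j, v j ≤ Real.exp (2 * c) * (w i / ∑ j, w j) := by
  have hV : 0 < ∑ j, v j := Finset.sum_pos (fun j _ => hv j) Finset.univ_nonempty
  have hW : 0 < ∑ j, w j := Finset.sum_pos (fun j _ => hw j) Finset.univ_nonempty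
  have hWV : ∑ j, w j ≤ Real.exp c * ∑ j, v j := by
    rw [Finset.mul_sum]
    exact Finset.sum_le_sum fun j _ => hwv j
  rw [← mul_div_assoc, div_le_div_iff₀ hV hW, two_mul, Real.exp_add]
  calc v i * ∑ j, w j ≤ (Real.exp c * w i) * (Real.exp c * ∑ j, v j) :=
        mul_le_mul (hvw i) hWV hW.le (mul_pos (Real.exp_pos c) (hw i)).le
    _ = Real.exp c * Real.exp c * w i * ∑ j, v j := by ring

lemma mul_exp_div_le_exp_mul {a x y β ε : ℝ} (ha : 0 ≤ a) (hβ : 0 < β) (h : x - y ≤ ε) :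
    a * Real.exp (x / β) ≤ Real.exp (ε / β) * (a * Real.exp (y / β)) := by
  rw [mul_left_comm, ← Real.exp_add, ← add_div]
  gcongr
  linarith

/-- **KL bound between Gibbs policies of nearby rewards (lemma in Theorem 3).**
If `|r i - rstar i| ≤ ε` for all `i`, then the KL divergence between the
corresponding Gibbs distributions satisfies `KL(πr ‖ πrstar) ≤ 2ε/β`. -/
theorem gibbs_kl_divergence_bound_of_reward_error
    (N : ℕ) (hN : 1 ≤ N)
    (πref : Fin N → ℝ) (href_pos : ∀ i, 0 < πref i) (href_sum : ∑ i, πref i = 1)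
    (r rstar : Fin N → ℝ) (β : ℝ) (hβ : 0 < β)
    (ε : ℝ) (hε : 0 ≤ ε) (herr : ∀ i, |r i - rstar i| ≤ ε)
    (πr : Fin N → ℝ)
    (hπr : ∀ i, πr i =
      πref i * Real.exp (r i / β) / ∑ j, πref j * Real.exp (r j / β))
    (πrstar : Fin N → ℝ)
    (hπrstar : ∀ i, πrstar i =
      πref i * Real.exp (rstar i / β) / ∑ j, πref j * Real.exp (rstar j / β)) :
    ∑ i, πr i * Real.log (πr i / πrstar i) ≤ 2 * ε / β := by
  have : Nonempty (Fin N) := ⟨⟨0, hN⟩⟩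
  have hpos : ∀ s : Fin N → ℝ, ∀ i, 0 < πref i * Real.exp (s i / β) :=
    fun s i => mul_pos (href_pos i) (Real.exp_pos _)
  have hZ : ∀ s : Fin N → ℝ, 0 < ∑ j, πref j * Real.exp (s j / β) :=
    fun s => Finset.sum_pos (fun j _ => hpos s j) Finset.univ_nonempty
  refine sum_mul_log_div_le_of_le_exp_mul (fun i => ?_) (fun i => ?_) ?_ fun i => ?_
  · rw [hπr]
    exact div_pos (hpos r i) (hZ r)
  · rw [hπrstar]
    exact div_pos (hpos rstar i) (hZ rstar)
  · simp_rw [hπr]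
    rw [← Finset.sum_div, div_self (hZ r).ne']
  · rw [hπr, hπrstar, mul_div_assoc 2]
    exact div_sum_le_exp_mul_div_sum (hpos r) (hpos rstar)
      (fun j => mul_exp_div_le_exp_mul (href_pos j).le hβ (abs_le.mp (herr j)).2)
      (fun j => mul_exp_div_le_exp_mul (href_pos j).le hβ
        (by linarith [(abs_le.mp (herr j)).1])) i
end

section
/- Fix an integer N ≥ 1, a reference distribution π_ref on {1,…,N}, β > 0, and ε ≥ 0. Let r* : {1,…,N} → ℝ be a perfect reward model, i.e., r*(i) ∈ {0,1} for all i, and let r : {1,…,N} → ℝ be a reward function with |r(i) − r*(i)| ≤ ε for all i. Let π_r and π_{r*} be the Gibbs distributions associated with r and r* respectively. Then the gap in expected correctness rate satisfies | Σ_{i=1}^N π_r(i)·r*(i) − Σ_{i=1}^N π_{r*}(i)·r*(i) | ≤ √(4ε/β). -/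
/-- The Gibbs distribution with reference weights `p`, reward `r` and temperature `β`. -/
noncomputable def gibbs {ι : Type*} [Fintype ι] (p : ι → ℝ) (β : ℝ) (r : ι → ℝ) (i : ι) : ℝ :=
  p i * Real.exp (r i / β) / ∑ j, p j * Real.exp (r j / β)

theorem gibbs_weight_le {ι : Type*} {p : ι → ℝ} {β ε : ℝ} {r s : ι → ℝ}
    (hp : ∀ i, 0 < p i) (hβ : 0 < β) (h : ∀ i, |r i - s i| ≤ ε) (i : ι) :
    p i * Real.exp (r i / β) ≤ Real.exp (ε / β) * (p i * Real.exp (s i / β)) := by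
  rw [mul_left_comm, ← Real.exp_add, ← add_div]
  have := (abs_le.mp (h i)).2
  have := (hp i).le
  gcongr
  linarith

section Gibbs

variable {ι : Type*} [Fintype ι] {p : ι → ℝ} {β ε : ℝ} {r s f : ι → ℝ}

theorem gibbs_partition_pos [Nonempty ι] (hp : ∀ i, 0 < p i) (β : ℝ) (r : ι → ℝ) :
    0 < ∑ j, p j * Real.exp (r j / β) :=
  Finset.sum_pos (fun j _ => mul_pos (hp j) (Real.exp_pos _)) Finset.univ_nonempty

theorem gibbs_nonneg [Nonempty ι] (hp : ∀ i, 0 < p i) (β : ℝ) (r : ι → ℝ) (i : ι) :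
    0 ≤ gibbs p β r i :=
  div_nonneg (mul_pos (hp i) (Real.exp_pos _)).le (gibbs_partition_pos hp β r).le

theorem sum_gibbs [Nonempty ι] (hp : ∀ i, 0 < p i) (β : ℝ) (r : ι → ℝ) :
    ∑ i, gibbs p β r i = 1 := by
  simp only [gibbs]
  rw [← Finset.sum_div, div_self (gibbs_partition_pos hp β r).ne']

/-- Rewards at distance at most `ε` have Gibbs distributions within a factor `exp (2 ε / β)`. -/
theorem gibbs_le_exp_mul [Nonempty ι] (hp : ∀ i, 0 < p i) (hβ : 0 < β)
    (h : ∀ i, |r i - s i| ≤ ε) (i : ι) :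
    gibbs p β r i ≤ Real.exp (2 * (ε / β)) * gibbs p β s i := by
  have hZ : ∑ j, p j * Real.exp (s j / β) ≤
      Real.exp (ε / β) * ∑ j, p j * Real.exp (r j / β) := by
    rw [Finset.mul_sum]
    exact Finset.sum_le_sum fun j _ =>
      gibbs_weight_le hp hβ (fun k => by rw [abs_sub_comm]; exact h k) j
  have hw := gibbs_weight_le hp hβ h i
  have hs := mul_pos (hp i) (Real.exp_pos (s i / β))
  rw [gibbs, gibbs, ← mul_div_assoc,
    div_le_div_iff₀ (gibbs_partition_pos hp β r) (gibbs_partition_pos hp β s), two_mul,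
    Real.exp_add]
  calc _ ≤ _ := mul_le_mul hw hZ (gibbs_partition_pos hp β s).le
        (mul_pos (Real.exp_pos _) hs).le
    _ = _ := by ring

theorem sum_gibbs_mul_mem_Icc [Nonempty ι] (hp : ∀ i, 0 < p i) (β : ℝ) (r : ι → ℝ)
    (hf : ∀ i, f i ∈ Set.Icc (0 : ℝ) 1) :
    ∑ i, gibbs p β r i * f i ∈ Set.Icc (0 : ℝ) 1 := by
  refine ⟨Finset.sum_nonneg fun i _ => mul_nonneg (gibbs_nonneg hp β r i) (hf i).1, ?_⟩
  rw [← sum_gibbs hp β r]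
  exact Finset.sum_le_sum fun i _ => mul_le_of_le_one_right (gibbs_nonneg hp β r i) (hf i).2

theorem sum_gibbs_mul_sub_le [Nonempty ι] (hp : ∀ i, 0 < p i) (hβ : 0 < β) (hε : 0 ≤ ε)
    (h : ∀ i, |r i - s i| ≤ ε) (hf : ∀ i, f i ∈ Set.Icc (0 : ℝ) 1) :
    ∑ i, gibbs p β r i * f i - ∑ i, gibbs p β s i * f i ≤ 2 * (ε / β) := by
  have hle : ∑ i, gibbs p β r i * f i ≤
      Real.exp (2 * (ε / β)) * ∑ i, gibbs p β s i * f i := by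
    rw [Finset.mul_sum]
    refine Finset.sum_le_sum fun i _ => ?_
    rw [← mul_assoc]
    exact mul_le_mul_of_nonneg_right (gibbs_le_exp_mul hp hβ h i) (hf i).1
  obtain ⟨h0, h1⟩ := sum_gibbs_mul_mem_Icc hp β r hf
  have hδ : 0 ≤ ε / β := div_nonneg hε hβ.le
  have hexp := Real.add_one_le_exp (-(2 * (ε / β)))
  have hle' : Real.exp (-(2 * (ε / β))) * ∑ i, gibbs p β r i * f i ≤
      ∑ i, gibbs p β s i * f i := by
    rw [Real.exp_neg]
    exact inv_mul_le_of_le_mul₀ (Real.exp_pos _).le (sum_gibbs_mul_mem_Icc hp β s hf).1 hle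
  nlinarith [mul_le_mul_of_nonneg_right hexp h0, mul_le_mul_of_nonneg_left h1 hδ]

end Gibbs

/-- **Theorem 3 (guaranteed performance with an imperfect reward model).**
Let `rstar` be a perfect reward model (`rstar i ∈ {0,1}` for all `i`) and `r` a
reward function with `|r i - rstar i| ≤ ε` pointwise. Then the gap in expected
correctness rate between the Gibbs policies induced by `r` and `rstar` is at most
`√(4ε/β)`. -/
theorem expected_correctness_gap_of_imperfect_reward_model
    (N : ℕ) (hN : 1 ≤ N)
    (πref : Fin N → ℝ) (href_pos : ∀ i, 0 < πref i) (href_sum : ∑ i, πref i = 1)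
    (β : ℝ) (hβ : 0 < β) (ε : ℝ) (hε : 0 ≤ ε)
    (rstar : Fin N → ℝ) (hstar : ∀ i, rstar i = 0 ∨ rstar i = 1)
    (r : Fin N → ℝ) (herr : ∀ i, |r i - rstar i| ≤ ε)
    (πr : Fin N → ℝ)
    (hπr : ∀ i, πr i =
      πref i * Real.exp (r i / β) / ∑ j, πref j * Real.exp (r j / β))
    (πrstar : Fin N → ℝ)
    (hπrstar : ∀ i, πrstar i =
      πref i * Real.exp (rstar i / β) / ∑ j, πref j * Real.exp (rstar j / β)) :
    |(∑ i, πr i * rstar i) - ∑ i, πrstar i * rstar i| ≤ Real.sqrt (4 * ε / β) := by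
  have : Nonempty (Fin N) := ⟨⟨0, hN⟩⟩
  obtain rfl : πr = gibbs πref β r := funext hπr
  obtain rfl : πrstar = gibbs πref β rstar := funext hπrstar
  have hf : ∀ i, rstar i ∈ Set.Icc (0 : ℝ) 1 := fun i => by
    rcases hstar i with h | h <;> simp [h]
  have hgap : |∑ i, gibbs πref β r i * rstar i - ∑ i, gibbs πref β rstar i * rstar i| ≤
      2 * (ε / β) :=
    abs_sub_le_iff.mpr ⟨sum_gibbs_mul_sub_le href_pos hβ hε herr hf,
      sum_gibbs_mul_sub_le href_pos hβ hε (fun i => by rw [abs_sub_comm]; exact herr i) hf⟩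
  obtain ⟨hr0, hr1⟩ := sum_gibbs_mul_mem_Icc href_pos β r hf
  obtain ⟨hs0, hs1⟩ := sum_gibbs_mul_mem_Icc href_pos β rstar hf
  have hone : |∑ i, gibbs πref β r i * rstar i - ∑ i, gibbs πref β rstar i * rstar i| ≤ 1 :=
    abs_sub_le_iff.mpr ⟨by linarith, by linarith⟩
  have hδ : 0 ≤ ε / β := div_nonneg hε hβ.le
  refine Real.le_sqrt_of_sq_le ?_
  rw [mul_div_assoc]
  linarith [pow_le_of_le_one (abs_nonneg _) hone two_ne_zero]
end
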